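/- Let W ∈ C²(ℝᵐ;ℝ), m ≥ 1, be nonnegative with W(u) > 0 for all u ≠ a and W(a) = 0 for some point a ∈ ℝᵐ, and assume there exist constants C₀ > 0, r₁ > 0 and q ≥ 2 such that W(a + rν) ≥ C₀ r^q for every unit vector ν ∈ S^{m-1} and every r ∈ (0, r₁). If u ∈ C²(ℝⁿ;ℝᵐ), n ≥ 2, is a bounded, globally minimizing solution of Δu = ∇W(u) on ℝⁿ, then for every τ with 0 < τ < 2/(qn) there exists a constant C(τ) > 0 such that ∫_{B_R} ( (1/2)|∇u|² + W(u) ) dx ≤ C(τ) R^{n-1-τ} for all R > 0. -/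

import Mathlib

open MeasureTheory Metric Filter RealInnerProductSpace

/-- Squared Frobenius norm of the gradient: `|∇u|² = Σᵢ |u_{xᵢ}|²`. -/
noncomputable def gradSq {n m : ℕ}
    (u : EuclideanSpace ℝ (Fin n) → EuclideanSpace ℝ (Fin m))
    (x : EuclideanSpace ℝ (Fin n)) : ℝ :=
  ∑ i : Fin n, ‖fderiv ℝ u x (EuclideanSpace.single i 1)‖ ^ 2

/-- The Laplacian of `u`, computed componentwise: `Δu = Σᵢ u_{xᵢxᵢ}`. -/
noncomputable def vlap {n m : ℕ}
    (u : EuclideanSpace ℝ (Fin n) → EuclideanSpace ℝ (Fin m))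
    (x : EuclideanSpace ℝ (Fin n)) : EuclideanSpace ℝ (Fin m) :=
  ∑ i : Fin n,
    fderiv ℝ (fun y => fderiv ℝ u y (EuclideanSpace.single i 1)) x (EuclideanSpace.single i 1)

/-- The Allen–Cahn energy `E(u;Ω) = ∫_Ω ((1/2)|∇u|² + W(u)) dx`. -/
noncomputable def energy {n m : ℕ} (W : EuclideanSpace ℝ (Fin m) → ℝ)
    (u : EuclideanSpace ℝ (Fin n) → EuclideanSpace ℝ (Fin m))
    (Ω : Set (EuclideanSpace ℝ (Fin n))) : ℝ :=
  ∫ x in Ω, ((1 / 2) * gradSq u x + W (u x))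

/-- `u` is a globally minimizing solution: for every bounded domain `Ω` and every
perturbation `φ ∈ W^{1,2}_0(Ω;ℝᵐ) ∩ L^∞(Ω;ℝᵐ)` (encoded as a Lipschitz, hence
bounded and `W^{1,2}`, function supported in `Ω`), `E(u;Ω) ≤ E(u+φ;Ω)`. -/
def GloballyMinimizing {n m : ℕ} (W : EuclideanSpace ℝ (Fin m) → ℝ)
    (u : EuclideanSpace ℝ (Fin n) → EuclideanSpace ℝ (Fin m)) : Prop :=
  ∀ Ω : Set (EuclideanSpace ℝ (Fin n)), IsOpen Ω → Bornology.IsBounded Ω →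
    ∀ φ : EuclideanSpace ℝ (Fin n) → EuclideanSpace ℝ (Fin m),
      (∃ K : NNReal, LipschitzWith K φ) → tsupport φ ⊆ Ω →
      energy W u Ω ≤ energy W (u + φ) Ω

lemma cutoff_exists (n : ℕ) : ∃ K : ℝ, 0 ≤ K ∧ ∀ R : ℝ, 0 ≤ R →
    ∃ ζ : EuclideanSpace ℝ (Fin n) → ℝ, ContDiff ℝ 2 ζ ∧ (∀ x, 0 ≤ ζ x) ∧ (∀ x, ζ x ≤ 1) ∧
      (∀ x, ‖x‖ ≤ R → ζ x = 1) ∧ (∀ x, R + 1 ≤ ‖x‖ → ζ x = 0) ∧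
      (∀ x, ‖fderiv ℝ ζ x‖ ≤ K) := by
  have hS : ContDiff ℝ 2 Real.smoothTransition := Real.smoothTransition.contDiff (n := 2)
  have hc : Continuous (deriv Real.smoothTransition) := hS.continuous_deriv (by norm_num)
  obtain ⟨K, hK⟩ := (isCompact_Icc (a := (0:ℝ)) (b := 1)).exists_bound_of_continuousOn
    hc.continuousOn
  refine ⟨|K| * 2, by positivity, fun R hR => ?_⟩
  set g : EuclideanSpace ℝ (Fin n) → ℝ := fun x => ((R + 1) ^ 2 - ‖x‖ ^ 2) * (2 * R + 1)⁻¹ with hg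
  have hgc : ContDiff ℝ 2 g := by
    have := contDiff_norm_sq ℝ (E := EuclideanSpace ℝ (Fin n)) (n := 2)
    exact (contDiff_const.sub this).mul contDiff_const
  have hpos : 0 < 2 * R + 1 := by positivity
  have h1 : ∀ x, ‖x‖ ≤ R → Real.smoothTransition (g x) = 1 := by
    intro x hx
    apply Real.smoothTransition.one_of_one_le
    simp only [hg]
    rw [← div_eq_mul_inv, le_div_iff₀ hpos]
    nlinarith [norm_nonneg x]
  have h0 : ∀ x, R + 1 ≤ ‖x‖ → Real.smoothTransition (g x) = 0 := by
    intro x hx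
    apply Real.smoothTransition.zero_of_nonpos
    simp only [hg]
    rw [← div_eq_mul_inv]
    apply div_nonpos_of_nonpos_of_nonneg _ hpos.le
    nlinarith [norm_nonneg x]
  refine ⟨fun x => Real.smoothTransition (g x), hS.comp hgc,
    fun x => Real.smoothTransition.nonneg _, fun x => Real.smoothTransition.le_one _, h1, h0, ?_⟩
  intro x
  by_cases hx : R + 1 ≤ ‖x‖
  · have : IsLocalMin (fun x => Real.smoothTransition (g x)) x := by
      refine Filter.Eventually.of_forall fun y => ?_
      simp only [h0 x hx]
      exact Real.smoothTransition.nonneg _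
    rw [this.fderiv_eq_zero]; simp
  by_cases hx' : ‖x‖ ≤ R
  · have : IsLocalMax (fun x => Real.smoothTransition (g x)) x := by
      refine Filter.Eventually.of_forall fun y => ?_
      simp only [h1 x hx']
      exact Real.smoothTransition.le_one _
    rw [this.fderiv_eq_zero]; simp
  push Not at hx hx'
  have hg' : HasFDerivAt g ((-(2:ℝ) * (2 * R + 1)⁻¹) • innerSL ℝ x) x := by
    have := ((hasStrictFDerivAt_norm_sq x).hasFDerivAt.const_sub ((R+1)^2)).mul_const (2*R+1)⁻¹
    refine this.congr_fderiv ?_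
    ext y
    simp
    ring
  have hd : HasFDerivAt (fun x => Real.smoothTransition (g x))
      (deriv Real.smoothTransition (g x) • ((-(2:ℝ) * (2 * R + 1)⁻¹) • innerSL ℝ x)) x :=
    ((hS.differentiable (by norm_num)) (g x)).hasDerivAt.comp_hasFDerivAt x hg'
  rw [hd.fderiv, norm_smul]
  have hgI : g x ∈ Set.Icc (0:ℝ) 1 := by
    simp only [hg, ← div_eq_mul_inv]
    constructor
    · apply div_nonneg _ hpos.le
      nlinarith [norm_nonneg x]
    · rw [div_le_one hpos]
      nlinarith [norm_nonneg x]
  gcongr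
  · exact (hK _ hgI).trans (le_abs_self K)
  · rw [norm_smul, innerSL_apply_norm, norm_mul, norm_neg, norm_inv, Real.norm_of_nonneg hpos.le,
      Real.norm_of_nonneg (by norm_num : (0:ℝ) ≤ 2), mul_assoc, inv_mul_eq_div]
    have : ‖x‖ / (2 * R + 1) ≤ 1 := by
      rw [div_le_one hpos]; linarith
    linarith

lemma gradSq_continuous {n m : ℕ} {u : EuclideanSpace ℝ (Fin n) → EuclideanSpace ℝ (Fin m)}
    (hu : ContDiff ℝ 2 u) : Continuous (gradSq u) := by
  have h := hu.continuous_fderiv (by norm_num)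
  unfold gradSq
  exact continuous_finsetSum _ fun i _ => ((h.clm_apply continuous_const).norm.pow 2)

lemma gradSq_nonneg {n m : ℕ} (u : EuclideanSpace ℝ (Fin n) → EuclideanSpace ℝ (Fin m)) (x) :
    0 ≤ gradSq u x := by
  unfold gradSq; positivity

lemma vec_ineq {E : Type*} [NormedAddCommGroup E] [InnerProductSpace ℝ E] (A b : E) (c : ℝ)
    (h0 : 0 ≤ c) (h1 : c ≤ 1) :
    ‖(1 - c ^ 2) • A - c • b‖ ^ 2 ≤ (1 - c ^ 2) * ‖A‖ ^ 2 + ‖b‖ ^ 2 := by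
  have key : (1 - c ^ 2) * ‖A‖ ^ 2 + ‖b‖ ^ 2 - ‖(1 - c ^ 2) • A - c • b‖ ^ 2
      = (1 - c ^ 2) * ‖c • A + b‖ ^ 2 := by
    rw [norm_sub_sq_real, norm_add_sq_real]
    simp only [norm_smul, inner_smul_left, inner_smul_right, mul_pow, Real.norm_eq_abs, sq_abs]
    simp
    ring
  have : 0 ≤ (1 - c ^ 2) * ‖c • A + b‖ ^ 2 := by
    apply mul_nonneg _ (sq_nonneg _)
    nlinarith
  linarith

lemma integrableOn_ball {n : ℕ} {f : EuclideanSpace ℝ (Fin n) → ℝ} (hf : Continuous f) (R : ℝ) :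
    IntegrableOn f (ball 0 R) :=
  (hf.continuousOn.integrableOn_compact (isCompact_closedBall 0 R)).mono_set ball_subset_closedBall

lemma vol_ball (n : ℕ) (R : ℝ) (hR : 0 < R) :
    volume.real (ball (0 : EuclideanSpace ℝ (Fin n)) R) =
      R ^ n * volume.real (ball (0 : EuclideanSpace ℝ (Fin n)) 1) := by
  rw [measureReal_def, Measure.addHaar_ball_of_pos _ _ hR]
  simp [measureReal_def, ENNReal.toReal_ofReal (pow_nonneg hR.le n)]

/-- Comparison with a cut-off competitor. -/
lemma comparison {n m : ℕ} (W : EuclideanSpace ℝ (Fin m) → ℝ) (hW : ContDiff ℝ 2 W)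
    (a : EuclideanSpace ℝ (Fin m)) (hWa : W a = 0) (hW0 : ∀ v, 0 ≤ W v)
    (u : EuclideanSpace ℝ (Fin n) → EuclideanSpace ℝ (Fin m)) (hu : ContDiff ℝ 2 u)
    (M : ℝ) (hM : ∀ x, ‖u x - a‖ ≤ M) (hmin : GloballyMinimizing W u) :
    ∃ C : ℝ, 0 ≤ C ∧ ∀ R : ℝ, 0 ≤ R → energy W u (ball 0 R) ≤
      C * ((∫ x in ball 0 (R + 1), ‖u x - a‖) - ∫ x in ball 0 R, ‖u x - a‖) := by
  have hM0 : 0 ≤ M := (norm_nonneg _).trans (hM 0)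
  obtain ⟨L, hL⟩ := (isCompact_closedBall a M).exists_bound_of_continuousOn
    (hW.continuous_fderiv (by norm_num)).continuousOn
  have hWL : ∀ v, ‖v - a‖ ≤ M → W v ≤ |L| * ‖v - a‖ := by
    intro v hv
    have := (convex_closedBall a M).norm_image_sub_le_of_norm_fderiv_le (𝕜 := ℝ) (f := W)
      (C := |L|) (fun x _ => hW.differentiable (by norm_num) x)
      (fun x hx => (hL x hx).trans (le_abs_self L)) (mem_closedBall_self hM0)
      (mem_closedBall_iff_norm.2 hv)
    rw [hWa, sub_zero] at this
    exact (le_abs_self _).trans this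
  obtain ⟨K, hK0, hK⟩ := cutoff_exists n
  refine ⟨n * (2 * K ^ 2 * M) + |L|, by positivity, fun R hR => ?_⟩
  obtain ⟨ζ, hζ, hζ0, hζ1, hζin, hζout, hζK⟩ := hK R hR
  set φ : EuclideanSpace ℝ (Fin n) → EuclideanSpace ℝ (Fin m) :=
    fun x => (-(ζ x) ^ 2) • (u x - a) with hφ
  have hφc : ContDiff ℝ 2 φ := ((hζ.pow 2).neg).smul (hu.sub contDiff_const)
  have hts : tsupport φ ⊆ closedBall 0 (R + 1) := by
    apply closure_minimal _ isClosed_closedBall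
    intro x hx
    by_contra hx'
    apply hx
    simp only [mem_closedBall, dist_zero_right, not_le] at hx'
    simp [hφ, hζout x hx'.le]
  have hcs : HasCompactSupport φ :=
    (isCompact_closedBall (0 : EuclideanSpace ℝ (Fin n)) (R + 1)).of_isClosed_subset
      (isClosed_tsupport φ) hts
  have hm := hmin (ball 0 (R + 2)) isOpen_ball isBounded_ball φ
    (ContDiff.lipschitzWith_of_hasCompactSupport hcs hφc (by norm_num))
    (hts.trans (closedBall_subset_ball (by linarith)))
  have hv : ∀ x, (u + φ) x - a = (1 - ζ x ^ 2) • (u x - a) := by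
    intro x
    simp only [hφ, Pi.add_apply]
    module
  have hζ2 : ∀ x, 0 ≤ 1 - ζ x ^ 2 := fun x => by nlinarith [hζ0 x, hζ1 x]
  have hdv : ∀ x e, fderiv ℝ (u + φ) x e = (1 - ζ x ^ 2) • fderiv ℝ u x e
      - ζ x • ((2 * fderiv ℝ ζ x e) • (u x - a)) := by
    intro x e
    have h1 := (hu.differentiable (by norm_num) x).hasFDerivAt
    have h2 := (hζ.differentiable (by norm_num) x).hasFDerivAt
    have h3 := h1.add (((h2.pow 2).neg).smul (h1.sub_const a))
    have h4 : HasFDerivAt (u + φ) _ x := h3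
    rw [h4.fderiv]
    simp
    module
  have hgrad : ∀ x, gradSq (u + φ) x ≤ (1 - ζ x ^ 2) * gradSq u x
      + ∑ i : Fin n, (2 * fderiv ℝ ζ x (EuclideanSpace.single i 1)) ^ 2 * ‖u x - a‖ ^ 2 := by
    intro x
    unfold gradSq
    rw [Finset.mul_sum, ← Finset.sum_add_distrib]
    apply Finset.sum_le_sum
    intro i _
    rw [hdv]
    refine (vec_ineq _ _ _ (hζ0 x) (hζ1 x)).trans ?_
    rw [norm_smul, mul_pow, Real.norm_eq_abs, sq_abs]
  have hgrad2 : ∀ x, gradSq (u + φ) x ≤ (1 - ζ x ^ 2) * gradSq u x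
      + 2 * (n * (2 * K ^ 2 * M)) * ‖u x - a‖ := by
    intro x
    refine (hgrad x).trans ?_
    have : ∑ i : Fin n, (2 * fderiv ℝ ζ x (EuclideanSpace.single i 1)) ^ 2 * ‖u x - a‖ ^ 2
        ≤ ∑ i : Fin n, (4 * K ^ 2 * M) * ‖u x - a‖ := by
      apply Finset.sum_le_sum
      intro i _
      have h1 : |fderiv ℝ ζ x (EuclideanSpace.single i 1)| ≤ K := by
        have := (fderiv ℝ ζ x).le_opNorm (EuclideanSpace.single i 1)
        simp at this
        exact this.trans (hζK x)
      have h2 : (2 * fderiv ℝ ζ x (EuclideanSpace.single i 1)) ^ 2 ≤ 4 * K ^ 2 := by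
        have := sq_le_sq' (by linarith [abs_nonneg (fderiv ℝ ζ x (EuclideanSpace.single i 1))]) h1
        rw [sq_abs] at this
        nlinarith
      have h3 : ‖u x - a‖ ^ 2 ≤ M * ‖u x - a‖ := by
        nlinarith [norm_nonneg (u x - a), hM x]
      calc _ ≤ (4 * K ^ 2) * (M * ‖u x - a‖) := by gcongr
        _ = _ := by ring
    simp at this
    nlinarith
  have hWv : ∀ x, W ((u + φ) x) ≤ |L| * ‖u x - a‖ := by
    intro x
    have h1 : ‖(u + φ) x - a‖ ≤ ‖u x - a‖ := by
      rw [hv, norm_smul, Real.norm_of_nonneg (hζ2 x)]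
      have : 1 - ζ x ^ 2 ≤ 1 := by nlinarith [sq_nonneg (ζ x)]
      nlinarith [norm_nonneg (u x - a)]
    refine (hWL _ (h1.trans (hM x))).trans ?_
    gcongr
  set C := n * (2 * K ^ 2 * M) + |L| with hC
  have hC0 : 0 ≤ C := by positivity
  set eu : EuclideanSpace ℝ (Fin n) → ℝ := fun x => (1 / 2) * gradSq u x + W (u x) with heu
  set ev : EuclideanSpace ℝ (Fin n) → ℝ :=
    fun x => (1 / 2) * gradSq (u + φ) x + W ((u + φ) x) with hev
  have hec : Continuous eu :=
    (continuous_const.mul (gradSq_continuous hu)).add (hW.continuous.comp hu.continuous)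
  have hvc : Continuous ev :=
    (continuous_const.mul (gradSq_continuous (hu.add hφc))).add
      (hW.continuous.comp (hu.add hφc).continuous)
  have hnc : Continuous fun x => ‖u x - a‖ := (hu.continuous.sub continuous_const).norm
  have heu0 : ∀ x, 0 ≤ eu x := fun x => by
    have := gradSq_nonneg u x
    have := hW0 (u x)
    simp only [heu]; linarith
  have hfd0 : ∀ x, (ζ x = 0 ∨ ζ x = 1) → fderiv ℝ ζ x = 0 := by
    rintro x (h | h)
    · have : IsLocalMin ζ x := Filter.Eventually.of_forall fun y => by rw [h]; exact hζ0 y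
      exact this.fderiv_eq_zero
    · have : IsLocalMax ζ x := Filter.Eventually.of_forall fun y => by rw [h]; exact hζ1 y
      exact this.fderiv_eq_zero
  -- pointwise comparison
  have hpt : ∀ x, ev x + (ball 0 R).indicator eu x + C * (ball 0 R).indicator (fun x => ‖u x - a‖) x
      ≤ eu x + C * (ball 0 (R + 1)).indicator (fun x => ‖u x - a‖) x := by
    intro x
    by_cases h1 : ‖x‖ < R
    · have hz := hζin x h1.le
      have hg := hgrad x
      rw [hfd0 x (Or.inr hz), hz] at hg
      simp at hg
      have hvx : (u + φ) x = a := by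
        have := hv x
        rw [hz] at this
        simpa [sub_eq_zero] using this
      rw [Set.indicator_of_mem (by simpa using h1), Set.indicator_of_mem (by simpa using h1),
        Set.indicator_of_mem (by simp; linarith)]
      have : ev x ≤ 0 := by
        simp only [hev, hvx, hWa]; linarith
      linarith
    · rw [Set.indicator_of_notMem (by simpa using h1), Set.indicator_of_notMem (by simpa using h1)]
      by_cases h2 : ‖x‖ < R + 1
      · rw [Set.indicator_of_mem (by simpa using h2)]
        have h3 := hgrad2 x
        have h4 := hWv x
        have h5 := hW0 (u x)
        have h6 : (1 - ζ x ^ 2) * gradSq u x ≤ gradSq u x := by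
          nlinarith [gradSq_nonneg u x, sq_nonneg (ζ x)]
        simp only [hev, heu, hC]
        linarith
      · rw [Set.indicator_of_notMem (by simpa using h2)]
        have hz := hζout x (not_lt.1 h2)
        have hg := hgrad x
        rw [hfd0 x (Or.inl hz), hz] at hg
        simp at hg
        have hvx : (u + φ) x = u x := by simp [hφ, hz]
        simp only [hev, heu, hvx]
        linarith
  -- integrate
  have iI : ∀ (f : EuclideanSpace ℝ (Fin n) → ℝ) (r : ℝ), Continuous f →
      IntegrableOn ((ball 0 r).indicator f) (ball 0 (R + 2)) := fun f r hf =>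
    (integrableOn_ball hf (R + 2)).indicator measurableSet_ball
  have hI : ∀ (f : EuclideanSpace ℝ (Fin n) → ℝ) (r : ℝ), r ≤ R + 2 →
      ∫ x in ball 0 (R + 2), (ball 0 r).indicator f x = ∫ x in ball 0 r, f x := by
    intro f r hr
    rw [setIntegral_indicator measurableSet_ball, Set.inter_eq_self_of_subset_right
      (ball_subset_ball hr)]
  have hint := setIntegral_mono (μ := volume) (s := ball 0 (R + 2))
    ((((integrableOn_ball hvc (R + 2)).add (iI eu R hec)).add ((iI _ R hnc).const_mul C)))
    ((integrableOn_ball hec (R + 2)).add ((iI _ (R + 1) hnc).const_mul C)) hpt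
  simp only [Pi.add_apply] at hint
  rw [integral_add (f := fun x => ev x + (ball 0 R).indicator eu x)
      ((integrableOn_ball hvc (R + 2)).add (iI eu R hec)) ((iI _ R hnc).const_mul C),
    integral_add (integrableOn_ball hvc (R + 2)) (iI eu R hec),
    integral_add (integrableOn_ball hec (R + 2)) ((iI _ (R + 1) hnc).const_mul C),
    integral_const_mul, integral_const_mul, hI _ _ (by linarith), hI _ _ (by linarith),
    hI _ _ (by linarith)] at hint
  change ∫ x in ball 0 (R + 2), eu x ≤ ∫ x in ball 0 (R + 2), ev x at hm
  change ∫ x in ball 0 R, eu x ≤ _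
  linarith

lemma lower_bound {m : ℕ} (W : EuclideanSpace ℝ (Fin m) → ℝ) (hW : Continuous W)
    (a : EuclideanSpace ℝ (Fin m)) (hWa : W a = 0) (hWpos : ∀ v, v ≠ a → 0 < W v)
    (C₀ r₁ q : ℝ) (hC₀ : 0 < C₀) (hr₁ : 0 < r₁) (hq : 2 ≤ q)
    (hlower : ∀ ν : EuclideanSpace ℝ (Fin m), ‖ν‖ = 1 →
      ∀ r : ℝ, 0 < r → r < r₁ → C₀ * r ^ q ≤ W (a + r • ν))
    (M : ℝ) (hM : 0 < M) :
    ∃ c : ℝ, 0 < c ∧ ∀ x, ‖x - a‖ ≤ M → c * ‖x - a‖ ^ q ≤ W x := by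
  have hw : ∃ w : ℝ, 0 < w ∧ ∀ x, ‖x - a‖ ≤ M → r₁ ≤ ‖x - a‖ → w ≤ W x := by
    have hcpt : IsCompact (closedBall a M ∩ {x | r₁ ≤ ‖x - a‖}) :=
      (isCompact_closedBall a M).inter_right
        (isClosed_le continuous_const (continuous_id.sub continuous_const).norm)
    rcases (closedBall a M ∩ {x | r₁ ≤ ‖x - a‖}).eq_empty_or_nonempty with he | hne
    · refine ⟨1, one_pos, fun x h1 h2 => ?_⟩
      have : x ∈ closedBall a M ∩ {x | r₁ ≤ ‖x - a‖} := ⟨mem_closedBall_iff_norm.2 h1, h2⟩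
      rw [he] at this
      exact this.elim
    · obtain ⟨y, hy, hmin⟩ := hcpt.exists_isMinOn hne hW.continuousOn
      refine ⟨W y, hWpos y ?_, fun x h1 h2 => hmin ⟨mem_closedBall_iff_norm.2 h1, h2⟩⟩
      rintro rfl
      have := hy.2
      simp at this
      linarith
  obtain ⟨w, hw0, hw⟩ := hw
  have hMq : 0 < M ^ q := Real.rpow_pos_of_pos hM q
  refine ⟨min C₀ (w / M ^ q), lt_min hC₀ (by positivity), fun x hx => ?_⟩
  by_cases hxa : x = a
  · subst hxa
    simp [hWa, Real.zero_rpow (by linarith : q ≠ 0)]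
  have hpos : 0 < ‖x - a‖ := norm_pos_iff.2 (sub_ne_zero.2 hxa)
  by_cases hr : ‖x - a‖ < r₁
  · have := hlower (‖x - a‖⁻¹ • (x - a)) (by rw [norm_smul, norm_inv, norm_norm]; field_simp)
      _ hpos hr
    rw [smul_smul, mul_inv_cancel₀ hpos.ne', one_smul, add_sub_cancel] at this
    refine le_trans ?_ this
    gcongr
    exact min_le_left _ _
  · calc _ ≤ (w / M ^ q) * M ^ q := by
          gcongr
          exact min_le_right _ _
      _ = w := by field_simp
      _ ≤ _ := hw x hx (not_lt.1 hr)

lemma interp (q c r w R : ℝ) (hq : 2 ≤ q) (hc : 0 < c) (hr : 0 ≤ r) (hw : c * r ^ q ≤ w)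
    (hR : 1 ≤ R) : r ≤ c⁻¹ * R ^ (1 - 1 / q) * w + R ^ (-(1 / q)) := by
  have hR0 : 0 < R := by linarith
  have hp : 0 < R ^ (-(1 / q)) := Real.rpow_pos_of_pos hR0 _
  have hp2 : 0 < R ^ (1 - 1 / q) := Real.rpow_pos_of_pos hR0 _
  have hrq : 0 ≤ r ^ q := Real.rpow_nonneg hr q
  have hw0 : 0 ≤ w := le_trans (by positivity) hw
  rcases le_or_gt r (R ^ (-(1 / q))) with h | h
  · have : 0 ≤ c⁻¹ * R ^ (1 - 1 / q) * w := by positivity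
    linarith
  · have hr0 : 0 < r := hp.trans h
    have h1 : R ^ (-(1 - 1 / q)) ≤ r ^ (q - 1) := by
      calc R ^ (-(1 - 1 / q)) = (R ^ (-(1 / q))) ^ (q - 1) := by
            rw [← Real.rpow_mul hR0.le]
            congr 1
            field_simp
        _ ≤ _ := Real.rpow_le_rpow hp.le h.le (by linarith)
    have h2 : r ^ q = r ^ (q - 1) * r := by
      rw [← Real.rpow_add_one hr0.ne']; simp
    have h3 : 1 ≤ R ^ (1 - 1 / q) * r ^ (q - 1) := by
      calc 1 = R ^ (1 - 1 / q) * R ^ (-(1 - 1 / q)) := by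
            rw [← Real.rpow_add hR0]; simp
        _ ≤ _ := by gcongr
    have h4 : r ≤ R ^ (1 - 1 / q) * r ^ q := by
      rw [h2, ← mul_assoc]
      nlinarith
    have h5 : r ^ q ≤ c⁻¹ * w := by
      rw [inv_mul_eq_div, le_div_iff₀ hc]; linarith
    calc r ≤ R ^ (1 - 1 / q) * (c⁻¹ * w) := h4.trans (by gcongr)
      _ = c⁻¹ * R ^ (1 - 1 / q) * w := by ring
      _ ≤ _ := by linarith

/-- Theorem 1.2 (quantitative energy growth): under the additional lower bound
`W(a + rν) ≥ C₀ rᑫ` near `a`, the energy over `B_R` is `O(R^{n-1-τ})` for every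
`0 < τ < 2/(qn)`. -/
theorem energy_growth_quantitative
    (n m : ℕ) (hn : 2 ≤ n) (hm : 1 ≤ m)
    (W : EuclideanSpace ℝ (Fin m) → ℝ) (hW : ContDiff ℝ 2 W)
    (a : EuclideanSpace ℝ (Fin m))
    (hWa : W a = 0) (hWpos : ∀ v, v ≠ a → 0 < W v)
    (C₀ r₁ q : ℝ) (hC₀ : 0 < C₀) (hr₁ : 0 < r₁) (hq : 2 ≤ q)
    (hlower : ∀ ν : EuclideanSpace ℝ (Fin m), ‖ν‖ = 1 →
      ∀ r : ℝ, 0 < r → r < r₁ → C₀ * r ^ q ≤ W (a + r • ν))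
    (u : EuclideanSpace ℝ (Fin n) → EuclideanSpace ℝ (Fin m))
    (hu : ContDiff ℝ 2 u)
    (hbdd : ∃ C, ∀ x, ‖u x‖ ≤ C)
    (hsol : ∀ x, vlap u x = gradient W (u x))
    (hmin : GloballyMinimizing W u) :
    ∀ τ : ℝ, 0 < τ → τ < 2 / (q * n) →
      ∃ C : ℝ, 0 < C ∧ ∀ R : ℝ, 0 < R →
        energy W u (ball 0 R) ≤ C * R ^ ((n : ℝ) - 1 - τ) := by
  intro τ hτ hτ2
  have hq0 : 0 < q := by linarith
  have hn' : (2:ℝ) ≤ n := by exact_mod_cast hn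
  have hW0 : ∀ v, 0 ≤ W v := fun v => by
    by_cases h : v = a
    · rw [h, hWa]
    · exact (hWpos v h).le
  have hτq : τ ≤ 1 / q := by
    refine hτ2.le.trans ?_
    rw [div_le_div_iff₀ (by positivity) hq0]
    nlinarith
  obtain ⟨M, hM0, hM⟩ : ∃ M : ℝ, 0 < M ∧ ∀ x, ‖u x - a‖ ≤ M := by
    obtain ⟨B, hB⟩ := hbdd
    have hB0 : 0 ≤ B := (norm_nonneg _).trans (hB 0)
    exact ⟨B + ‖a‖ + 1, by positivity, fun x => by
      have := norm_sub_le (u x) a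
      have := hB x
      linarith⟩
  obtain ⟨C₁, hC₁, hcmp⟩ := comparison W hW a hWa hW0 u hu M hM hmin
  obtain ⟨c, hc, hlow⟩ := lower_bound W hW.continuous a hWa hWpos C₀ r₁ q hC₀ hr₁ hq hlower M hM0
  set ω := volume.real (ball (0 : EuclideanSpace ℝ (Fin n)) 1) with hω
  have hω0 : 0 ≤ ω := measureReal_nonneg
  set f : ℝ → ℝ := fun t => ∫ x in ball 0 t, ‖u x - a‖ with hf
  have hnc : Continuous fun x => ‖u x - a‖ := (hu.continuous.sub continuous_const).norm
  set e : EuclideanSpace ℝ (Fin n) → ℝ := fun x => (1 / 2) * gradSq u x + W (u x) with he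
  have hec : Continuous e :=
    (continuous_const.mul (gradSq_continuous hu)).add (hW.continuous.comp hu.continuous)
  have he0 : ∀ x, 0 ≤ e x := fun x => by
    have := gradSq_nonneg u x
    have := hW0 (u x)
    simp only [he]; linarith
  have hEdef : ∀ R, energy W u (ball 0 R) = ∫ x in ball 0 R, e x := fun R => rfl
  have hE0 : ∀ R, 0 ≤ energy W u (ball 0 R) := fun R => by
    rw [hEdef]; exact integral_nonneg he0
  have hEmono : ∀ R S, R ≤ S → energy W u (ball 0 R) ≤ energy W u (ball 0 S) := by
    intro R S h
    rw [hEdef, hEdef]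
    exact setIntegral_mono_set (integrableOn_ball hec S) (Eventually.of_forall he0)
      (ball_subset_ball h).eventuallyLE
  have hf0 : ∀ t, 0 ≤ f t := fun t => integral_nonneg fun x => norm_nonneg _
  have hfmono : ∀ R S, R ≤ S → f R ≤ f S := by
    intro R S h
    exact setIntegral_mono_set (integrableOn_ball hnc S)
      (Eventually.of_forall fun x => norm_nonneg _) (ball_subset_ball h).eventuallyLE
  have hconst : ∀ (k R : ℝ), 0 < R →
      ∫ _x in ball (0 : EuclideanSpace ℝ (Fin n)) R, k = k * (R ^ n * ω) := by
    intro k R hR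
    rw [setIntegral_const, vol_ball n R hR, smul_eq_mul]
    ring
  -- telescoping
  have htel : ∀ R, 0 ≤ R → ∀ N : ℕ, N * energy W u (ball 0 R) ≤ C₁ * (f (R + N) - f R) := by
    intro R hR N
    induction N with
    | zero => simp
    | succ N ih =>
      have h1 := hcmp (R + N) (by positivity)
      have h2 := hEmono R (R + N) (by linarith [Nat.cast_nonneg (α := ℝ) N])
      push_cast
      rw [← add_assoc]
      simp only [hf] at ih ⊢
      linarith
  have hRE : ∀ R, 1 ≤ R → R * energy W u (ball 0 R) ≤ C₁ * f (3 * R) := by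
    intro R hR
    have h1 := htel R (by linarith) ⌈R⌉₊
    have h2 := Nat.le_ceil R
    have h3 := (Nat.ceil_lt_add_one (by linarith : 0 ≤ R)).le
    have h4 := hfmono (R + ⌈R⌉₊) (3 * R) (by linarith)
    calc R * energy W u (ball 0 R) ≤ ⌈R⌉₊ * energy W u (ball 0 R) :=
          mul_le_mul_of_nonneg_right h2 (hE0 R)
      _ ≤ _ := h1
      _ ≤ C₁ * f (3 * R) := by
          apply mul_le_mul_of_nonneg_left _ hC₁
          linarith [hf0 R]
  have hnn : ∀ R : ℝ, 0 < R → R ^ n = R * R ^ ((n : ℝ) - 1) := by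
    intro R hR
    rw [mul_comm, ← Real.rpow_add_one hR.ne', ← Real.rpow_natCast]
    simp
  have hE1 : ∀ R, 1 ≤ R →
      energy W u (ball 0 R) ≤ (C₁ * (M * (3 ^ n * ω))) * R ^ ((n : ℝ) - 1) := by
    intro R hR
    have hR0 : 0 < R := by linarith
    have h1 := hRE R hR
    have h2 : f (3 * R) ≤ M * ((3 * R) ^ n * ω) := by
      rw [← hconst M (3 * R) (by positivity)]
      exact setIntegral_mono (integrableOn_ball hnc _)
        (integrableOn_ball continuous_const _) hM
    rw [mul_pow, hnn R hR0] at h2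
    have h3 := mul_le_mul_of_nonneg_left h2 hC₁
    refine le_of_mul_le_mul_left ?_ hR0
    linarith
  set C₂ := C₁ * (M * (3 ^ n * ω)) with hC₂
  have hC₂0 : 0 ≤ C₂ := by positivity
  set C₃ := C₁ * (c⁻¹ * (C₂ * 3 ^ ((n : ℝ) - 1)) + 3 ^ n * ω) with hC₃
  have hC₃0 : 0 ≤ C₃ := by positivity
  have hE2 : ∀ R, 1 ≤ R → energy W u (ball 0 R) ≤ C₃ * R ^ ((n : ℝ) - 1 - 1 / q) := by
    intro R hR
    have hR0 : 0 < R := by linarith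
    have h1 := hRE R hR
    have h2 : f (3 * R) ≤ c⁻¹ * R ^ (1 - 1 / q) * energy W u (ball 0 (3 * R))
        + R ^ (-(1 / q)) * ((3 * R) ^ n * ω) := by
      rw [← hconst _ (3 * R) (by positivity), hEdef, ← integral_const_mul,
        ← integral_add ((integrableOn_ball hec _).const_mul _) (integrableOn_ball continuous_const _)]
      refine setIntegral_mono (integrableOn_ball hnc _)
        (((integrableOn_ball hec _).const_mul _).add (integrableOn_ball continuous_const _)) ?_
      intro x
      refine interp q c ‖u x - a‖ (e x) R hq hc (norm_nonneg _) ?_ hR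
      refine (hlow (u x) (hM x)).trans ?_
      have := gradSq_nonneg u x
      simp only [he]; linarith
    have h3 := hE1 (3 * R) (by linarith)
    rw [Real.mul_rpow (by norm_num) hR0.le] at h3
    have e1 : R ^ (1 - 1 / q) * R ^ ((n : ℝ) - 1) = R * R ^ ((n : ℝ) - 1 - 1 / q) := by
      rw [← Real.rpow_add hR0, mul_comm, ← Real.rpow_add_one hR0.ne']
      congr 1; ring
    have e2 : R ^ (-(1 / q)) * R ^ n = R * R ^ ((n : ℝ) - 1 - 1 / q) := by
      rw [hnn R hR0, mul_left_comm, ← Real.rpow_add hR0]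
      congr 2; ring
    have h4 : f (3 * R) ≤ (c⁻¹ * (C₂ * 3 ^ ((n : ℝ) - 1)) + 3 ^ n * ω) *
        (R * R ^ ((n : ℝ) - 1 - 1 / q)) := by
      calc f (3 * R) ≤ c⁻¹ * R ^ (1 - 1 / q) * (C₂ * (3 ^ ((n : ℝ) - 1) * R ^ ((n : ℝ) - 1)))
            + R ^ (-(1 / q)) * ((3 * R) ^ n * ω) := by
              refine h2.trans ?_
              gcongr
        _ = (c⁻¹ * (C₂ * 3 ^ ((n : ℝ) - 1))) * (R ^ (1 - 1 / q) * R ^ ((n : ℝ) - 1))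
            + 3 ^ n * ω * (R ^ (-(1 / q)) * R ^ n) := by rw [mul_pow]; ring
        _ = _ := by rw [e1, e2]; ring
    have h5 := mul_le_mul_of_nonneg_left h4 hC₁
    refine le_of_mul_le_mul_left ?_ hR0
    refine (h1.trans h5).trans (le_of_eq ?_)
    rw [hC₃]; ring
  obtain ⟨B, hB⟩ := (isCompact_closedBall (0 : EuclideanSpace ℝ (Fin n)) 1).exists_bound_of_continuousOn
    hec.continuousOn
  have hB0 : 0 ≤ B := (norm_nonneg _).trans (hB 0 (by simp))
  refine ⟨C₃ + B * ω + 1, by positivity, fun R hR => ?_⟩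
  have hpow : 0 ≤ R ^ ((n : ℝ) - 1 - τ) := Real.rpow_nonneg hR.le _
  rcases le_or_gt 1 R with h | h
  · calc energy W u (ball 0 R) ≤ C₃ * R ^ ((n : ℝ) - 1 - 1 / q) := hE2 R h
      _ ≤ C₃ * R ^ ((n : ℝ) - 1 - τ) :=
          mul_le_mul_of_nonneg_left (Real.rpow_le_rpow_of_exponent_le h (by linarith)) hC₃0
      _ ≤ _ := mul_le_mul_of_nonneg_right (by nlinarith [mul_nonneg hB0 hω0]) hpow
  · have h1 : energy W u (ball 0 R) ≤ B * (R ^ n * ω) := by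
      rw [hEdef, ← hconst B R hR]
      refine setIntegral_mono_on (integrableOn_ball hec _) (integrableOn_ball continuous_const _)
        measurableSet_ball fun x hx => ?_
      exact (le_abs_self _).trans (hB x (by
        simp only [mem_ball, mem_closedBall] at hx ⊢; linarith))
    have h2 : R ^ n ≤ R ^ ((n : ℝ) - 1 - τ) := by
      rw [← Real.rpow_natCast]
      exact Real.rpow_le_rpow_of_exponent_ge hR h.le (by linarith)
    calc energy W u (ball 0 R) ≤ B * (R ^ n * ω) := h1
      _ ≤ B * (R ^ ((n : ℝ) - 1 - τ) * ω) := by gcongr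
      _ = B * ω * R ^ ((n : ℝ) - 1 - τ) := by ring
      _ ≤ _ := mul_le_mul_of_nonneg_right (by linarith) hpow
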